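/- arXiv:2007.01258 — 2 statements merged into one kernel-verified Lean document; each statement's English description precedes it below -/
import Mathlib

section
/- Let p, q be positive integers, let D_θ be an invertible real p×p matrix, D_η a real p×q matrix, Σ_ψ a real symmetric positive semidefinite p×p matrix, Υ_{ηη} and Σ real symmetric positive definite q×q matrices, and ρ > 0. Set K = (Υ_{ηη}⁻¹ + (ρΣ)⁻¹)⁻¹ and let T be the (p+q)×(p+q) block matrix with blocks T₁₁ = −D_θ⁻¹, T₁₂ = −D_θ⁻¹ D_η, T₂₁ = 0, T₂₂ = I. Define A = T · BlockDiag(Σ_ψ, ρΣ) · Tᵀ and B = T · BlockDiag(Σ_ψ, K) · Tᵀ. Then B ⪯ A in the Loewner order. -/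
open Matrix

/-- Theorem 3 (matrix content): the asymptotic variance `B` of the Type II
estimator is dominated, in the Loewner order, by the asymptotic variance `A`
of the Type I estimator.  Here `T` is the common congruence factor,
`A = T · BlockDiag(Sψ, ρS) · Tᵀ` and `B = T · BlockDiag(Sψ, K) · Tᵀ` with
`K = (Υηη⁻¹ + (ρS)⁻¹)⁻¹`  (`Sψ` plays the role of `Σ_ψ` and `S` of `Σ`). -/
theorem typeII_le_typeI {p q : ℕ} (hp : 0 < p) (hq : 0 < q)
    (Dθ : Matrix (Fin p) (Fin p) ℝ) (hDθ : IsUnit Dθ)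
    (Dη : Matrix (Fin p) (Fin q) ℝ)
    (Sψ : Matrix (Fin p) (Fin p) ℝ) (hSψ : Sψ.PosSemidef) (hSψsymm : Sψ.IsSymm)
    (Υηη S : Matrix (Fin q) (Fin q) ℝ) (hΥηη : Υηη.PosDef) (hS : S.PosDef)
    (ρ : ℝ) (hρ : 0 < ρ)
    (K : Matrix (Fin q) (Fin q) ℝ) (hK : K = (Υηη⁻¹ + (ρ • S)⁻¹)⁻¹)
    (T : Matrix (Fin p ⊕ Fin q) (Fin p ⊕ Fin q) ℝ)
    (hT : T = fromBlocks (-(Dθ⁻¹)) (-(Dθ⁻¹ * Dη)) 0 1)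
    (A B : Matrix (Fin p ⊕ Fin q) (Fin p ⊕ Fin q) ℝ)
    (hA : A = T * fromBlocks Sψ 0 0 (ρ • S) * Tᵀ)
    (hB : B = T * fromBlocks Sψ 0 0 K * Tᵀ) :
    (A - B).PosSemidef := by
  have hC : (ρ • S).PosDef := hS.smul hρ
  generalize ρ • S = C at *
  have hP : (Υηη⁻¹).PosDef := hΥηη.inv
  generalize Υηη⁻¹ = P at *
  have hM : (P + C⁻¹).PosDef := hP.add hC.inv
  have hKpd : K.PosDef := hK ▸ hM.inv
  have e1 : (P + C⁻¹) * K = 1 := by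
    rw [hK]; exact Matrix.mul_nonsing_inv _ ((Matrix.isUnit_iff_isUnit_det _).1 hM.isUnit)
  have e2 : K * (P + C⁻¹) = 1 := by
    rw [hK]; exact Matrix.nonsing_inv_mul _ ((Matrix.isUnit_iff_isUnit_det _).1 hM.isUnit)
  have hCdet := (Matrix.isUnit_iff_isUnit_det _).1 hC.isUnit
  have c1 : C * C⁻¹ = 1 := Matrix.mul_nonsing_inv _ hCdet
  have c2 : C⁻¹ * C = 1 := Matrix.nonsing_inv_mul _ hCdet
  have f1 : C = C * P * K + K := by
    calc C = C * ((P + C⁻¹) * K) := by rw [e1, mul_one]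
      _ = C * P * K + (C * C⁻¹) * K := by noncomm_ring
      _ = _ := by rw [c1, one_mul]
  have f2 : C = K * P * C + K := by
    calc C = (K * (P + C⁻¹)) * C := by rw [e2, one_mul]
      _ = K * P * C + K * (C⁻¹ * C) := by noncomm_ring
      _ = _ := by rw [c2, mul_one]
  have f3 : C - K = K * (P * C * P) * K + K * P * K := by
    calc C - K = C * P * K := by rw [sub_eq_iff_eq_add]; exact f1
      _ = (K * P * C + K) * P * K := by rw [← f2]
      _ = _ := by noncomm_ring
  have hZ : (C - K).PosSemidef := by
    rw [f3]
    have h1 := hC.posSemidef.mul_mul_conjTranspose_same P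
    rw [hP.isHermitian.eq] at h1
    have h2 := h1.mul_mul_conjTranspose_same K
    have h3 := hP.posSemidef.mul_mul_conjTranspose_same K
    rw [hKpd.isHermitian.eq] at h2 h3
    exact h2.add h3
  have hD : A - B = T * ((fromRows (0 : Matrix (Fin p) (Fin q) ℝ) (1 : Matrix (Fin q) (Fin q) ℝ)) * (C - K) *
      (fromRows (0 : Matrix (Fin p) (Fin q) ℝ) (1 : Matrix (Fin q) (Fin q) ℝ))ᴴ) * Tᴴ := by
    rw [hA, hB, ← sub_mul, ← mul_sub, conjTranspose_eq_transpose_of_trivial T]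
    congr 2
    ext (i | i) (j | j) <;>
      simp [transpose_fromRows, fromRows_mul, mul_fromCols]
  rw [hD]
  exact (hZ.mul_mul_conjTranspose_same _).mul_mul_conjTranspose_same T
end

section
/- Let Υ be a real symmetric positive definite matrix on the index set Fin p ⊕ Fin q, written in blocks Υ = [[Υ_{θθ}, Υ_{θη}], [Υ_{ηθ}, Υ_{ηη}]] with Υ_{ηθ} = Υ_{θη}ᵀ, and let S be a real symmetric positive definite q×q matrix. Set K = (Υ_{ηη}⁻¹ + S⁻¹)⁻¹. Then the inverse of Υ⁻¹ + [[0,0],[0,S⁻¹]] equals the block matrix with (1,1) block Υ_{θθ} − Υ_{θη}(Υ_{ηη} + S)⁻¹Υ_{ηθ}, (1,2) block Υ_{θη}Υ_{ηη}⁻¹K, (2,1) block KΥ_{ηη}⁻¹Υ_{ηθ}, and (2,2) block K. -/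
open Matrix

/-- Explicit block form of the combined variance matrix `C` in Theorem 5:
writing `Υ = [[Υθθ, Υθη], [Υθηᵀ, Υηη]]` (symmetric positive definite) and
`K = (Υηη⁻¹ + S⁻¹)⁻¹`, the matrix `(Υ⁻¹ + [[0,0],[0,S⁻¹]])⁻¹` equals
`[[Υθθ − Υθη (Υηη + S)⁻¹ Υθηᵀ, Υθη Υηη⁻¹ K], [K Υηη⁻¹ Υθηᵀ, K]]`. -/
theorem combined_variance_blocks {p q : ℕ}
    (Υθθ : Matrix (Fin p) (Fin p) ℝ) (Υθη : Matrix (Fin p) (Fin q) ℝ)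
    (Υηη : Matrix (Fin q) (Fin q) ℝ)
    (Υ : Matrix (Fin p ⊕ Fin q) (Fin p ⊕ Fin q) ℝ)
    (hΥ : Υ = fromBlocks Υθθ Υθη Υθηᵀ Υηη)
    (hΥpd : Υ.PosDef)
    (S : Matrix (Fin q) (Fin q) ℝ) (hS : S.PosDef)
    (K : Matrix (Fin q) (Fin q) ℝ) (hK : K = (Υηη⁻¹ + S⁻¹)⁻¹) :
    (Υ⁻¹ + fromBlocks 0 0 0 S⁻¹)⁻¹ =
      fromBlocks (Υθθ - Υθη * (Υηη + S)⁻¹ * Υθηᵀ) (Υθη * Υηη⁻¹ * K)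
        (K * Υηη⁻¹ * Υθηᵀ) K := by
  have hD : Υηη.PosDef := by
    have h := hΥpd.submatrix (e := Sum.inr) Sum.inr_injective
    have e : Υ.submatrix (Sum.inr : Fin q → Fin p ⊕ Fin q) Sum.inr = Υηη := by
      subst hΥ; ext i j; rfl
    rwa [e] at h
  have uΥ : IsUnit Υ.det := (isUnit_iff_isUnit_det _).1 hΥpd.isUnit
  have uD : IsUnit Υηη.det := (isUnit_iff_isUnit_det _).1 hD.isUnit
  have uS : IsUnit S.det := (isUnit_iff_isUnit_det _).1 hS.isUnit
  have uK : IsUnit (Υηη⁻¹ + S⁻¹).det :=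
    (isUnit_iff_isUnit_det _).1 (hD.inv.add hS.inv).isUnit
  have hfac : Υηη⁻¹ + S⁻¹ = Υηη⁻¹ * (Υηη + S) * S⁻¹ := by
    rw [Matrix.mul_add, Matrix.add_mul, nonsing_inv_mul _ uD, Matrix.one_mul,
      Matrix.mul_assoc, mul_nonsing_inv _ uS, Matrix.mul_one, add_comm]
  have hK1 : S⁻¹ * K * Υηη⁻¹ = (Υηη + S)⁻¹ := by
    rw [hK, hfac, Matrix.mul_inv_rev, Matrix.mul_inv_rev, nonsing_inv_nonsing_inv _ uS,
      nonsing_inv_nonsing_inv _ uD, nonsing_inv_mul_cancel_left _ _ uS,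
      mul_nonsing_inv_cancel_right _ _ uD]
  have hK2 : Υηη⁻¹ * K + S⁻¹ * K = 1 := by
    rw [← Matrix.add_mul, hK, mul_nonsing_inv _ uK]
  have hK3 : K + Υηη * (S⁻¹ * K) = Υηη := by
    have := congrArg (Υηη * ·) hK2
    simpa only [Matrix.mul_add, mul_nonsing_inv_cancel_left _ _ uD, Matrix.mul_one] using this
  have key : fromBlocks (Υθθ - Υθη * (Υηη + S)⁻¹ * Υθηᵀ) (Υθη * Υηη⁻¹ * K)
        (K * Υηη⁻¹ * Υθηᵀ) K + Υ * (fromBlocks 0 0 0 S⁻¹ *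
        fromBlocks (Υθθ - Υθη * (Υηη + S)⁻¹ * Υθηᵀ) (Υθη * Υηη⁻¹ * K)
        (K * Υηη⁻¹ * Υθηᵀ) K) = Υ := by
    rw [hΥ, fromBlocks_multiply, fromBlocks_multiply, fromBlocks_add]
    simp only [Matrix.zero_mul, Matrix.mul_zero, zero_add, add_zero]
    congr 1
    · rw [← hK1]
      simp only [Matrix.mul_assoc, sub_add_cancel]
    · rw [Matrix.mul_assoc, ← Matrix.mul_add, hK2, Matrix.mul_one]
    · have : K * Υηη⁻¹ * Υθηᵀ + Υηη * (S⁻¹ * (K * Υηη⁻¹ * Υθηᵀ))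
          = (K + Υηη * (S⁻¹ * K)) * Υηη⁻¹ * Υθηᵀ := by
        simp only [Matrix.add_mul, Matrix.mul_assoc]
      rw [this, hK3, mul_nonsing_inv _ uD, Matrix.one_mul]
  apply inv_eq_right_inv
  have h2 := congrArg (Υ⁻¹ * ·) key
  simp only [Matrix.mul_add, nonsing_inv_mul_cancel_left _ _ uΥ, nonsing_inv_mul _ uΥ] at h2
  rw [Matrix.add_mul]
  exact h2
end
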